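/- arXiv:1603.06307 — 3 statements merged into one kernel-verified Lean document; each statement's English description precedes it below -/
import Mathlib

section
/- For every positive integer n, arctan(φ^(4n-1)) = 3·arctan(1) − (1/2)·arctan(1/2) − arctan(F_{2n-1} / F_{2n}). -/
open Real Finset

/-- The Lucas numbers: `L 0 = 2`, `L 1 = 1`, `L (n+2) = L (n+1) + L n`. -/
def lucas : ℕ → ℕ
  | 0 => 2
  | 1 => 1
  | n + 2 => lucas (n + 1) + lucas n

/-- The golden ratio `φ = (1 + √5)/2`. -/
noncomputable def phi : ℝ := (1 + Real.sqrt 5) / 2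

theorem phi_eq_goldenRatio : phi = Real.goldenRatio := rfl

theorem phi_sq : phi ^ 2 = phi + 1 := Real.goldenRatio_sq

theorem one_lt_phi : 1 < phi := Real.one_lt_goldenRatio

theorem half_arctan_half : (1 / 2) * Real.arctan (1 / 2) = π / 2 - Real.arctan (phi ^ 3) := by
  have h := phi_sq
  have h1 := one_lt_phi
  have hc : phi ^ 3 = 2 * phi + 1 := by linear_combination (phi + 1) * h
  have h3 : 1 < phi ^ 3 := by linarith
  have hpos : 0 < phi ^ 3 := by linarith
  rw [← Real.arctan_inv_of_pos hpos]
  have hlt : (phi ^ 3)⁻¹ < 1 := inv_lt_one_of_one_lt₀ h3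
  have hgt : -1 < (phi ^ 3)⁻¹ := by linarith [inv_pos.mpr hpos]
  have h2 := Real.two_mul_arctan hgt hlt
  have harg : 2 * (phi ^ 3)⁻¹ / (1 - (phi ^ 3)⁻¹ ^ 2) = 1 / 2 := by
    have hne : phi ^ 3 ≠ 0 := hpos.ne'
    have hd : 1 - (phi ^ 3)⁻¹ ^ 2 ≠ 0 := by nlinarith [inv_pos.mpr hpos]
    rw [div_eq_iff hd]
    field_simp
    linear_combination (3 - 2 * phi - phi ^ 3) * hc - 4 * h
  rw [harg] at h2
  linarith

/-- Binet's formula for consecutive Fibonacci numbers, as a ratio in terms of `phi` alone. -/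
theorem fib_odd_div_fib_even (m : ℕ) :
    (Nat.fib (2 * m + 1) : ℝ) / (Nat.fib (2 * m + 2) : ℝ) =
      phi * ((phi ^ (2 * m + 1)) ^ 2 + 1) / (phi ^ 2 * (phi ^ (2 * m + 1)) ^ 2 - 1) := by
  have h1 := one_lt_phi
  have hp : phi ≠ 0 := by linarith
  have hy : 1 ≤ phi ^ (2 * m + 1) := one_le_pow₀ h1.le
  have hψ : Real.goldenConj = -phi⁻¹ := by
    rw [phi_eq_goldenRatio, Real.inv_goldenRatio, neg_neg]
  have hψ1 : Real.goldenConj ^ (2 * m + 1) = -(phi ^ (2 * m + 1))⁻¹ := by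
    rw [hψ, Odd.neg_pow ⟨m, rfl⟩, inv_pow]
  rw [Real.coe_fib_eq, Real.coe_fib_eq, pow_succ _ (2 * m + 1), pow_succ _ (2 * m + 1), hψ1, hψ,
    ← phi_eq_goldenRatio, div_div_div_cancel_right₀ (by positivity)]
  generalize phi ^ (2 * m + 1) = y at hy ⊢
  have hy0 : y ≠ 0 := by linarith
  have hd : 0 < phi ^ 2 * y ^ 2 - 1 := by nlinarith [one_le_pow₀ hy (n := 2)]
  have e : y * phi - -y⁻¹ * -phi⁻¹ = (phi ^ 2 * y ^ 2 - 1) / (phi * y) := by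
    field_simp
  have hd' := hd.ne'
  rw [e]
  field_simp
  ring

theorem stmt7 (n : ℕ) (hn : 1 ≤ n) :
    Real.arctan (phi ^ (4 * n - 1)) =
      3 * Real.arctan 1 - (1 / 2) * Real.arctan (1 / 2)
        - Real.arctan ((Nat.fib (2 * n - 1) : ℝ) / (Nat.fib (2 * n) : ℝ)) := by
  obtain ⟨m, rfl⟩ : ∃ m, n = m + 1 := ⟨n - 1, by omega⟩
  have e1 : 4 * (m + 1) - 1 = (2 * m + 1) * 2 + 1 := by omega
  have e2 : 2 * (m + 1) - 1 = 2 * m + 1 := by omega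
  have e3 : 2 * (m + 1) = 2 * m + 2 := by omega
  rw [e1, e2, e3, fib_odd_div_fib_even, half_arctan_half, pow_succ, pow_mul]
  have h := phi_sq
  have h1 := one_lt_phi
  have hy : 1 ≤ phi ^ (2 * m + 1) := one_le_pow₀ h1.le
  generalize phi ^ (2 * m + 1) = y at hy ⊢
  have hd : 0 < phi ^ 2 * y ^ 2 - 1 := by nlinarith [one_le_pow₀ hy (n := 2)]
  have hc : phi ^ 3 = 2 * phi + 1 := by linear_combination (phi + 1) * h
  have hprod : 1 < y ^ 2 * phi * (phi * (y ^ 2 + 1) / (phi ^ 2 * y ^ 2 - 1)) := by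
    rw [mul_div_assoc', one_lt_div hd]
    have : 0 ≤ phi ^ 2 * y ^ 4 := by positivity
    linarith
  have hl := Real.arctan_add_eq_add_pi hprod (by positivity)
  have hr := Real.arctan_add_eq_add_pi (x := 1) (y := phi ^ 3) (by linarith) one_pos
  have hrv : (1 + phi ^ 3) / (1 - 1 * phi ^ 3) = -phi := by
    rw [div_eq_iff (by linarith)]
    linear_combination (1 - phi) * hc - 2 * h
  have hlv : (y ^ 2 * phi + phi * (y ^ 2 + 1) / (phi ^ 2 * y ^ 2 - 1)) /
      (1 - y ^ 2 * phi * (phi * (y ^ 2 + 1) / (phi ^ 2 * y ^ 2 - 1))) = -phi := by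
    rw [div_eq_iff (by linarith)]
    have hq := div_mul_cancel₀ (phi * (y ^ 2 + 1)) hd.ne'
    apply mul_right_cancel₀ hd.ne'
    linear_combination (1 - phi ^ 2 * y ^ 2) * hq
  rw [hlv] at hl
  rw [hrv, Real.arctan_one] at hr
  rw [Real.arctan_one]
  linarith
end

section
/- For every non-negative integer k, 2·arctan(1 / φ^(2k)) = arctan(√5 / L_{2k+1}) + arctan(1 / (F_{2k+1}·√5)). -/
open Real Finset

theorem lucas_eq_goldenRatio_pow_add_goldenConj_pow :
    ∀ n : ℕ, (lucas n : ℝ) = goldenRatio ^ n + goldenConj ^ n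
  | 0 => by norm_num [lucas]
  | 1 => by simp [lucas]
  | n + 2 => by
    rw [lucas, Nat.cast_add, lucas_eq_goldenRatio_pow_add_goldenConj_pow (n + 1),
      lucas_eq_goldenRatio_pow_add_goldenConj_pow n, pow_add goldenRatio n 2,
      pow_add goldenConj n 2, goldenRatio_sq, goldenConj_sq]
    ring

theorem goldenConj_pow_odd (k : ℕ) :
    goldenConj ^ (2 * k + 1) = -(goldenRatio * goldenRatio ^ (2 * k))⁻¹ := by
  rw [← neg_eq_iff_eq_neg.mpr inv_goldenRatio, Odd.neg_pow ⟨k, rfl⟩, inv_pow, pow_succ']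

theorem sqrt_five_eq_goldenRatio_add_inv : √5 = goldenRatio + goldenRatio⁻¹ := by
  rw [inv_goldenRatio, ← sub_eq_add_neg, goldenRatio_sub_goldenConj]

theorem lucas_odd_eq (k : ℕ) :
    (lucas (2 * k + 1) : ℝ) =
      goldenRatio * goldenRatio ^ (2 * k) - (goldenRatio * goldenRatio ^ (2 * k))⁻¹ := by
  rw [lucas_eq_goldenRatio_pow_add_goldenConj_pow, goldenConj_pow_odd, pow_succ']
  ring

theorem fib_odd_mul_sqrt_five (k : ℕ) :
    (Nat.fib (2 * k + 1) : ℝ) * √5 =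
      goldenRatio * goldenRatio ^ (2 * k) + (goldenRatio * goldenRatio ^ (2 * k))⁻¹ := by
  rw [coe_fib_eq, div_mul_cancel₀ _ (by positivity), goldenConj_pow_odd, pow_succ']
  ring

theorem arctan_sqrt_five_div_lucas_odd (k : ℕ) :
    arctan (√5 / (lucas (2 * k + 1) : ℝ)) =
      arctan (1 / goldenRatio ^ (2 * k)) +
        arctan (1 / (goldenRatio ^ 2 * goldenRatio ^ (2 * k))) := by
  rw [lucas_odd_eq, sqrt_five_eq_goldenRatio_add_inv]
  have hu : 1 ≤ goldenRatio ^ (2 * k) := one_le_pow₀ one_lt_goldenRatio.le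
  generalize goldenRatio ^ (2 * k) = u at hu ⊢
  have hφ := one_lt_goldenRatio
  have hφu : 1 < goldenRatio * u := by nlinarith
  have hlt : 1 < goldenRatio ^ 2 * u ^ 2 := by nlinarith
  have h₂ : goldenRatio * u - (goldenRatio * u)⁻¹ ≠ 0 := by
    have := inv_lt_one_of_one_lt₀ hφu
    linarith
  have h₃ : 1 / u * (1 / (goldenRatio ^ 2 * u)) < 1 := by
    rw [one_div_mul_one_div, div_lt_one (by positivity)]
    linarith
  rw [arctan_add h₃]
  congr 1
  rw [div_eq_div_iff h₂ (by linarith)]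
  field_simp

theorem arctan_one_div_fib_odd_mul_sqrt_five (k : ℕ) :
    arctan (1 / ((Nat.fib (2 * k + 1) : ℝ) * √5)) =
      arctan (1 / goldenRatio ^ (2 * k)) -
        arctan (1 / (goldenRatio ^ 2 * goldenRatio ^ (2 * k))) := by
  rw [fib_odd_mul_sqrt_five]
  have hu : 0 < goldenRatio ^ (2 * k) := pow_pos goldenRatio_pos _
  generalize goldenRatio ^ (2 * k) = u at hu ⊢
  have hφ := goldenRatio_pos
  have hsq := goldenRatio_sq
  generalize goldenRatio = g at hφ hsq ⊢
  have h : 0 < 1 / u * (1 / (g ^ 2 * u)) := by positivity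
  rw [sub_eq_add_neg, ← arctan_neg, arctan_add (by linarith)]
  congr 1
  rw [div_eq_div_iff (by positivity) (by linarith)]
  field_simp
  linear_combination -(g ^ 2 * u ^ 2 + 1) * hsq

theorem stmt10 (k : ℕ) :
    2 * Real.arctan (1 / phi ^ (2 * k)) =
      Real.arctan (Real.sqrt 5 / (lucas (2 * k + 1) : ℝ))
        + Real.arctan (1 / ((Nat.fib (2 * k + 1) : ℝ) * Real.sqrt 5)) := by
  rw [show phi = goldenRatio from rfl, arctan_sqrt_five_div_lucas_odd,
    arctan_one_div_fib_odd_mul_sqrt_five]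
  ring
end

section
/- For every positive integer n, arctan(2 / L_{2n-1}) = arctan(1 / F_{2n}) + arctan(1 / L_{2n}). -/
open Real Finset

theorem lucas_add_fib (k : ℕ) : lucas k + Nat.fib k = 2 * Nat.fib (k + 1) := by
  induction k using Nat.twoStepInduction with
  | zero => simp [lucas]
  | one => simp [lucas]
  | more k h₀ h₁ =>
    have h₂ := Nat.fib_add_two (n := k)
    have h₃ := Nat.fib_add_two (n := k + 1)
    simp only [lucas]
    grind

/-- Cassini's identity at even index, written without subtraction. -/
theorem fib_even_sq_add_one (m : ℕ) :
    Nat.fib (2 * m + 2) ^ 2 + 1 =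
      Nat.fib (2 * m + 1) * Nat.fib (2 * m + 2) + Nat.fib (2 * m + 1) ^ 2 := by
  induction m with
  | zero => simp
  | succ m ih =>
    have h₃ := Nat.fib_add_two (n := 2 * m + 1)
    have h₄ := Nat.fib_add_two (n := 2 * m + 2)
    rw [show 2 * (m + 1) + 2 = 2 * m + 2 + 2 by ring, show 2 * (m + 1) + 1 = 2 * m + 1 + 2 by ring,
      h₄, h₃]
    linarith

theorem stmt14 (n : ℕ) (hn : 1 ≤ n) :
    Real.arctan (2 / (lucas (2 * n - 1) : ℝ)) =
      Real.arctan (1 / (Nat.fib (2 * n) : ℝ)) + Real.arctan (1 / (lucas (2 * n) : ℝ)) := by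
  obtain ⟨m, rfl⟩ : ∃ m, n = m + 1 := ⟨n - 1, by omega⟩
  rw [show 2 * (m + 1) - 1 = 2 * m + 1 by omega, show 2 * (m + 1) = 2 * m + 2 by ring]
  have hodd : (lucas (2 * m + 1) : ℝ) + Nat.fib (2 * m + 1) = 2 * Nat.fib (2 * m + 2) := by
    exact_mod_cast lucas_add_fib (2 * m + 1)
  have heven : (lucas (2 * m + 2) : ℝ) = 2 * Nat.fib (2 * m + 1) + Nat.fib (2 * m + 2) := by
    have h := lucas_add_fib (2 * m + 2)
    have h₃ := Nat.fib_add_two (n := 2 * m + 1)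
    have h' : lucas (2 * m + 2) = 2 * Nat.fib (2 * m + 1) + Nat.fib (2 * m + 2) := by
      grind
    exact_mod_cast h'
  have hcassini : (Nat.fib (2 * m + 2) : ℝ) ^ 2 + 1 =
      Nat.fib (2 * m + 1) * Nat.fib (2 * m + 2) + (Nat.fib (2 * m + 1) : ℝ) ^ 2 := by
    exact_mod_cast fib_even_sq_add_one m
  have ha : (1 : ℝ) ≤ Nat.fib (2 * m + 1) := by
    exact_mod_cast Nat.fib_pos.2 (Nat.succ_pos (2 * m))
  have hab : (Nat.fib (2 * m + 1) : ℝ) ≤ Nat.fib (2 * m + 2) := by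
    exact_mod_cast Nat.fib_le_fib_succ
  rw [heven, eq_sub_of_add_eq hodd]
  generalize (Nat.fib (2 * m + 1) : ℝ) = a at *
  generalize (Nat.fib (2 * m + 2) : ℝ) = b at *
  have hb : 0 < b := by linarith
  have hc : 0 < 2 * a + b := by linarith
  have hd : 0 < 2 * b - a := by linarith
  have hbc : 1 < b * (2 * a + b) := by nlinarith
  have hlt : 1 / b * (1 / (2 * a + b)) < 1 := by
    rw [one_div_mul_one_div, div_lt_one (by positivity)]
    exact hbc
  rw [Real.arctan_add hlt]
  congr 1
  rw [div_eq_div_iff hd.ne' (by linarith)]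
  field_simp
  linear_combination -2 * hcassini
end
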